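/- arXiv:2602.11331 — 3 statements merged into one kernel-verified Lean document; each statement's English description precedes it below -/
import Mathlib

section
/- Let p ≥ 2 and r, q ≥ 1 be integers and let G = G(r,p,q) = K_1 ⊕ (p K_r ∪ q(K_1 ⊕ (K_1 ∪ K_2))). Then (x + (r+1))^{p−1} divides the characteristic polynomial det(x·I − D(G)) in ℝ[x]; equivalently, −(r+1) is an eigenvalue of the distance matrix D(G) with multiplicity at least p − 1. -/
open Polynomial SimpleGraph Sum

noncomputable section

/-- The distance matrix of a graph, with real entries. -/
def distMatrix {V : Type*} [Fintype V] (G : SimpleGraph V) : Matrix V V ℝ :=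
  Matrix.of fun u v => (G.dist u v : ℝ)

/-- The second largest distance eigenvalue: the eigenvalues of the distance matrix
(the roots of its characteristic polynomial, with multiplicity) are sorted in
increasing order, and we take the one at position `card V - 2`. -/
def lambda2 {V : Type*} [Fintype V] [DecidableEq V] (G : SimpleGraph V) : ℝ :=
  ((distMatrix G).charpoly.roots.sort (· ≤ ·)).getD (Fintype.card V - 2) 0

/-- The diameter of a finite graph. -/
def graphDiam {V : Type*} [Fintype V] (G : SimpleGraph V) : ℕ :=
  Finset.univ.sup fun p : V × V => G.dist p.1 p.2

/-- A graph is chordal if every cycle of length at least 4 has a chord. -/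
def IsChordal {V : Type*} (G : SimpleGraph V) : Prop :=
  ∀ (v : V) (c : G.Walk v v), c.IsCycle → 4 ≤ c.length →
    ∃ u w : V, u ∈ c.support ∧ w ∈ c.support ∧ G.Adj u w ∧ s(u, w) ∉ c.edges

/-- Ptolemaic graph: the Ptolemy inequality for the graph distance. -/
def IsPtolemaic {V : Type*} (G : SimpleGraph V) : Prop :=
  ∀ u v w x : V,
    G.dist u v * G.dist w x ≤ G.dist u w * G.dist v x + G.dist u x * G.dist v w

/-- `S` is a `uv`-separator: `u, v ∉ S` and every walk from `u` to `v` meets `S`. -/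
def IsUVSeparator {V : Type*} (G : SimpleGraph V) (S : Finset V) (u v : V) : Prop :=
  u ∉ S ∧ v ∉ S ∧ ∀ w : G.Walk u v, ∃ x ∈ w.support, x ∈ S

/-- `S` is a minimal vertex separator: a minimal `uv`-separator for some pair of
distinct non-adjacent vertices `u, v`. -/
def IsMinimalVertexSeparator {V : Type*} (G : SimpleGraph V) (S : Finset V) : Prop :=
  ∃ u v : V, u ≠ v ∧ ¬ G.Adj u v ∧ IsUVSeparator G S u v ∧
    ∀ T : Finset V, T ⊂ S → ¬ IsUVSeparator G T u v

/-- A connected component `K` of `G − S` is full if every vertex of `S` has a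
neighbour in `K`. -/
def IsFullComponent {V : Type*} (G : SimpleGraph V) (S : Finset V)
    (K : (G.induce ((S : Set V)ᶜ)).ConnectedComponent) : Prop :=
  ∀ a ∈ S, ∃ x : ((S : Set V)ᶜ : Set V),
    (G.induce ((S : Set V)ᶜ)).connectedComponentMk x = K ∧ G.Adj a ↑x

/-- The join `G ⊕ H` of two vertex-disjoint graphs. -/
def graphJoin {α β : Type*} (G : SimpleGraph α) (H : SimpleGraph β) :
    SimpleGraph (α ⊕ β) :=
  SimpleGraph.fromRel fun x y =>
    (∃ a b, x = Sum.inl a ∧ y = Sum.inl b ∧ G.Adj a b) ∨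
    (∃ a b, x = Sum.inr a ∧ y = Sum.inr b ∧ H.Adj a b) ∨
    (x.isLeft ∧ y.isRight)

/-- The disjoint union of two vertex-disjoint graphs. -/
def graphSum {α β : Type*} (G : SimpleGraph α) (H : SimpleGraph β) :
    SimpleGraph (α ⊕ β) :=
  SimpleGraph.fromRel fun x y =>
    (∃ a b, x = Sum.inl a ∧ y = Sum.inl b ∧ G.Adj a b) ∨
    (∃ a b, x = Sum.inr a ∧ y = Sum.inr b ∧ H.Adj a b)

/-- `p` disjoint copies of the complete graph `K_r`. -/
def cliqueCopies (p r : ℕ) : SimpleGraph (Fin p × Fin r) :=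
  SimpleGraph.fromRel fun x y => x.1 = y.1

/-- `q` disjoint copies of `K_1 ⊕ (K_1 ∪ K_2)` (the paw graph): in each copy,
vertex 0 is universal, vertex 1 is otherwise isolated, vertices 2,3 form a `K_2`. -/
def pawCopies (q : ℕ) : SimpleGraph (Fin q × Fin 4) :=
  SimpleGraph.fromRel fun x y => x.1 = y.1 ∧ (x.2 = 0 ∨ (x.2 = 2 ∧ y.2 = 3))

/-- `s` disjoint copies of the path `P_3`. -/
def path3Copies (s : ℕ) : SimpleGraph (Fin s × Fin 3) :=
  SimpleGraph.fromRel fun x y => x.1 = y.1 ∧ ((x.2 = 0 ∧ y.2 = 1) ∨ (x.2 = 1 ∧ y.2 = 2))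

/-- The disjoint union `p_1 K_{r_1} ∪ ⋯ ∪ p_k K_{r_k}`. -/
def multiCliques (k : ℕ) (p r : Fin k → ℕ) :
    SimpleGraph ((i : Fin k) × (Fin (p i) × Fin (r i))) :=
  SimpleGraph.fromRel fun x y =>
    (⟨x.1, x.2.1⟩ : (i : Fin k) × Fin (p i)) = ⟨y.1, y.2.1⟩

/-- The relaxed block star
`K_1 ⊕ ((p_1 K_{r_1} ∪ ⋯ ∪ p_k K_{r_k}) ∪ q (K_1 ⊕ (K_1 ∪ K_2)) ∪ s P_3)`. -/
def relaxedBlockStar (k : ℕ) (p r : Fin k → ℕ) (q s : ℕ) :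
    SimpleGraph (Unit ⊕ (((i : Fin k) × (Fin (p i) × Fin (r i))) ⊕
      ((Fin q × Fin 4) ⊕ (Fin s × Fin 3)))) :=
  graphJoin (⊤ : SimpleGraph Unit)
    (graphSum (multiCliques k p r) (graphSum (pawCopies q) (path3Copies s)))

/-- The graph `G(r,p,q) = K_1 ⊕ (p K_r ∪ q (K_1 ⊕ (K_1 ∪ K_2)))`. -/
def Grpq (r p q : ℕ) : SimpleGraph (Unit ⊕ ((Fin p × Fin r) ⊕ (Fin q × Fin 4))) :=
  graphJoin (⊤ : SimpleGraph Unit) (graphSum (cliqueCopies p r) (pawCopies q))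

/-- The full house graph `K_2 ⊕ (K_1 ∪ K_2)`: vertices 0,1 form the join-`K_2`,
vertex 2 is the `K_1`, vertices 3,4 form the `K_2`. -/
def fullHouse : SimpleGraph (Fin 5) :=
  SimpleGraph.fromRel fun x y => x = 0 ∨ x = 1 ∨ (x = 3 ∧ y = 4)

/-- The diamond graph: `K_4` minus an edge. -/
def diamondGraph : SimpleGraph (Fin 4) :=
  SimpleGraph.fromRel fun x y => x = 0 ∨ x = 1

/-- The path on four vertices. -/
def path4 : SimpleGraph (Fin 4) :=
  SimpleGraph.fromRel fun x y => (x : ℕ) + 1 = (y : ℕ)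

/-- The cycle on four vertices. -/
def cycle4 : SimpleGraph (Fin 4) :=
  SimpleGraph.fromRel fun x y => x + 1 = y

/-- The triple block graph `Pt_2(p,q)`: a full house (on `Fin 5`, with the
join-`K_2` being vertices `a = 0`, `b = 1`) together with `p - 1` further vertices
forming with `a` a clique `K_p` and `q - 1` further vertices forming with `b`
a clique `K_q`. -/
def Pt2Graph (p q : ℕ) : SimpleGraph (Fin 5 ⊕ (Fin (p - 1) ⊕ Fin (q - 1))) :=
  SimpleGraph.fromRel fun x y =>
    match x, y with
    | Sum.inl a, Sum.inl b => a = 0 ∨ a = 1 ∨ (a = 3 ∧ b = 4)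
    | Sum.inl a, Sum.inr (Sum.inl _) => a = 0
    | Sum.inl a, Sum.inr (Sum.inr _) => a = 1
    | Sum.inr (Sum.inl _), Sum.inr (Sum.inl _) => True
    | Sum.inr (Sum.inr _), Sum.inr (Sum.inr _) => True
    | _, _ => False

/-- The nine-vertex graph `Pt_1`: a full house (vertices 0,…,4, join-`K_2` being
`a = 0`, `b = 1`, `K_2` being 3,4), a vertex 5 adjacent only to `a`, a vertex 6
adjacent only to `b`, and vertices 7,8 adjacent to each other and to `b`. -/
def Pt1Graph : SimpleGraph (Fin 9) :=
  SimpleGraph.fromRel fun x y =>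
    (x = 0 ∧ (y = 1 ∨ y = 2 ∨ y = 3 ∨ y = 4 ∨ y = 5)) ∨
    (x = 1 ∧ (y = 2 ∨ y = 3 ∨ y = 4 ∨ y = 6 ∨ y = 7 ∨ y = 8)) ∨
    (x = 3 ∧ y = 4) ∨ (x = 7 ∧ y = 8)

/-- `G` contains an induced subgraph isomorphic to `H`. -/
def HasInducedSubgraph {V W : Type*} (G : SimpleGraph V) (H : SimpleGraph W) : Prop :=
  ∃ s : Set V, Nonempty ((G.induce s) ≃g H)

/-- `G` is isomorphic to a connected induced subgraph of `H`. -/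
def IsoToConnectedInducedSubgraph {V W : Type*} (G : SimpleGraph V)
    (H : SimpleGraph W) : Prop :=
  ∃ s : Set W, (H.induce s).Connected ∧ Nonempty (G ≃g (H.induce s))

/-- A vertex is simplicial if its neighbourhood is a clique. -/
def IsSimplicial {V : Type*} (G : SimpleGraph V) (v : V) : Prop :=
  G.IsClique (G.neighborSet v)

/-- The quintic polynomial `f(r,p,q,x)`. -/
def fpoly (r p q : ℕ) : Polynomial ℝ :=
  X ^ 5 - C (8 * (q : ℝ) + 2 * (r : ℝ) * (p : ℝ) - (r : ℝ) - 8) * X ^ 4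
    - C ((8 * (r : ℝ) + 36) * (q : ℝ) + 15 * (r : ℝ) * (p : ℝ) - 7 * (r : ℝ) - 20) * X ^ 3
    - C ((28 * (r : ℝ) + 52) * (q : ℝ) + 33 * (r : ℝ) * (p : ℝ) - 13 * (r : ℝ) - 18) * X ^ 2
    - C ((24 * (r : ℝ) + 30) * (q : ℝ) + 23 * (r : ℝ) * (p : ℝ) - 5 * (r : ℝ) - 5) * X
    - C ((6 * (r : ℝ) + 6) * (q : ℝ) + 5 * (r : ℝ) * (p : ℝ))

end

/-- Linearly independent eigenvectors of a matrix for a common eigenvalue give a power of the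
corresponding linear factor dividing the characteristic polynomial. -/
theorem Matrix.X_sub_C_pow_card_dvd_charpoly {n ι K : Type*} [Fintype n] [DecidableEq n]
    [Fintype ι] [Field K] (A : Matrix n n K) (μ : K) (v : ι → n → K)
    (hv : LinearIndependent K v) (hA : ∀ i, A.mulVec (v i) = μ • v i) :
    (X - C μ) ^ Fintype.card ι ∣ A.charpoly := by
  have hmem : ∀ i, v i ∈ Module.End.eigenspace A.toLin' μ := fun i => by
    rw [Module.End.mem_eigenspace_iff, Matrix.toLin'_apply, hA]
  have hcard : Fintype.card ι ≤ Module.finrank K (Module.End.eigenspace A.toLin' μ) := by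
    rw [← finrank_span_eq_card hv]
    exact Submodule.finrank_mono (Submodule.span_le.2 (Set.range_subset_iff.2 hmem))
  have hroot := hcard.trans (LinearMap.finrank_eigenspace_le A.toLin' μ)
  rw [Matrix.charpoly_toLin'] at hroot
  exact (le_rootMultiplicity_iff A.charpoly_monic.ne_zero).1 hroot

/-- Distances in a graph with a universal vertex. -/
theorem SimpleGraph.dist_of_universal {V : Type*} [DecidableEq V] (G : SimpleGraph V)
    [DecidableRel G.Adj] (c : V) (hc : ∀ v, v ≠ c → G.Adj c v) (u v : V) :
    G.dist u v = if u = v then 0 else if G.Adj u v then 1 else 2 := by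
  split_ifs with huv hadj
  · simp [huv]
  · exact dist_eq_one_iff_adj.2 hadj
  · have hu : u ≠ c := fun h => hadj (h ▸ hc v (fun h' => huv (h.trans h'.symm)))
    have hv : v ≠ c := fun h => hadj (h ▸ (hc u hu).symm)
    have h : G.edist u v = 2 :=
      edist_eq_two_iff.2 ⟨huv, hadj, c, (hc u hu).symm, (hc v hv).symm⟩
    simp [SimpleGraph.dist, h]

theorem Grpq_dist (r p q : ℕ) (x y : Unit ⊕ ((Fin p × Fin r) ⊕ (Fin q × Fin 4))) :
    haveI := Classical.decRel (Grpq r p q).Adj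
    (Grpq r p q).dist x y = if x = y then 0 else if (Grpq r p q).Adj x y then 1 else 2 := by
  classical
  convert (Grpq r p q).dist_of_universal (inl ()) ?_ x y
  rintro (⟨⟩ | v) hv
  · exact absurd rfl hv
  · simp [Grpq, graphJoin]

theorem Grpq_dist_clique_clique (r p q : ℕ) (j k : Fin p) (a b : Fin r) :
    (Grpq r p q).dist (inr (inl (k, a))) (inr (inl (j, b))) =
      if k = j then (if a = b then 0 else 1) else 2 := by
  rw [Grpq_dist]
  by_cases hjk : k = j <;> by_cases hab : a = b <;>
    simp [Grpq, graphJoin, graphSum, cliqueCopies, hjk, hab, eq_comm (a := j)]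

theorem Grpq_dist_apex_clique (r p q : ℕ) (j : Fin p) (b : Fin r) :
    (Grpq r p q).dist (inl ()) (inr (inl (j, b))) = 1 := by
  rw [Grpq_dist]
  simp [Grpq, graphJoin]

theorem Grpq_dist_paw_clique (r p q : ℕ) (s : Fin q × Fin 4) (j : Fin p) (b : Fin r) :
    (Grpq r p q).dist (inr (inr s)) (inr (inl (j, b))) = 2 := by
  rw [Grpq_dist]
  simp [Grpq, graphJoin, graphSum]

/-- The vector on the vertices of `G(r,p,q)` taking the constant value `w j` on the `j`-th clique
and vanishing at all other vertices. -/
def cliqueVector {p : ℕ} (r q : ℕ) (w : Fin p → ℝ) :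
    Unit ⊕ ((Fin p × Fin r) ⊕ (Fin q × Fin 4)) → ℝ :=
  Sum.elim 0 (Sum.elim (fun x => w x.1) 0)

theorem distMatrix_mulVec_cliqueVector (r p q : ℕ) (w : Fin p → ℝ) (hw : ∑ j, w j = 0) :
    (distMatrix (Grpq r p q)).mulVec (cliqueVector r q w) =
      (-((r : ℝ) + 1)) • cliqueVector r q w := by
  funext x
  simp only [Matrix.mulVec, dotProduct, distMatrix, Matrix.of_apply, Fintype.sum_sum_type,
    cliqueVector, Sum.elim_inl, Sum.elim_inr, Pi.zero_apply, mul_zero, Finset.sum_const_zero,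
    zero_add, add_zero, Fintype.sum_prod_type, Pi.smul_apply, smul_eq_mul]
  rcases x with ⟨⟨⟩⟩ | ⟨k, a⟩ | s
  · simp [Grpq_dist_apex_clique, ← Finset.mul_sum, hw]
  · have hterm : ∀ j b, ((Grpq r p q).dist (inr (inl (k, a))) (inr (inl (j, b))) : ℝ) * w j =
        2 * w j - if k = j then (w j + if a = b then w j else 0) else 0 := fun j b => by
      rw [Grpq_dist_clique_clique]
      split_ifs <;> push_cast <;> ring
    have hrow : ∀ j, ∑ b, ((Grpq r p q).dist (inr (inl (k, a))) (inr (inl (j, b))) : ℝ) * w j =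
        r * 2 * w j - if k = j then (r + 1) * w j else 0 := fun j => by
      simp_rw [hterm]
      split_ifs <;> simp [Finset.sum_add_distrib] <;> ring
    simp_rw [hrow]
    simp [← Finset.mul_sum, hw]
    ring
  · simp [Grpq_dist_paw_clique, ← Finset.mul_sum, hw]

/-- For `p ≥ 2` and `r, q ≥ 1`, `(x + (r+1))^(p-1)` divides the characteristic
polynomial of the distance matrix of `G(r,p,q)`. -/
theorem stmt_10 (r p q : ℕ) (hp : 2 ≤ p) (hr : 0 < r) (hq : 0 < q) :
    (X + C ((r : ℝ) + 1)) ^ (p - 1) ∣ (distMatrix (Grpq r p q)).charpoly := by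
  obtain ⟨m, rfl⟩ : ∃ m, p = m + 1 := ⟨p - 1, by omega⟩
  let v : Fin m → Unit ⊕ ((Fin (m + 1) × Fin r) ⊕ (Fin q × Fin 4)) → ℝ :=
    fun i => cliqueVector r q (Fin.cons (-1) (Pi.single i 1))
  have hv : LinearIndependent ℝ v := by
    rw [Fintype.linearIndependent_iff]
    intro g hg i
    have h := congrFun hg (inr (inl (i.succ, ⟨0, hr⟩)))
    simpa [v, cliqueVector, Finset.sum_apply, Pi.single_apply] using h
  have hdvd := (distMatrix (Grpq r (m + 1) q)).X_sub_C_pow_card_dvd_charpoly (-((r : ℝ) + 1)) v hv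
    fun i => distMatrix_mulVec_cliqueVector r (m + 1) q _ (by simp [Fin.sum_univ_succ])
  simpa [sub_eq_add_neg, add_comm] using hdvd
end

section
/- For all integers r, p, q ≥ 1, the polynomial f(r,p,q,x) = x^5 − A x^4 − B x^3 − C x^2 − D x − E, where A = 8q + 2rp − r − 8, B = (8r+36)q + 15rp − 7r − 20, C = (28r+52)q + 33rp − 13r − 18, D = (24r+30)q + 23rp − 5r − 5 and E = (6r+6)q + 5rp, divides the characteristic polynomial det(x·I − D(G(r,p,q))) in ℝ[x], where G(r,p,q) = K_1 ⊕ (p K_r ∪ q(K_1 ⊕ (K_1 ∪ K_2))). -/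
open Polynomial SimpleGraph Sum

namespace Matrix

variable {R V m : Type*} [CommRing R] [Fintype V] [DecidableEq V] [Fintype m] [DecidableEq m]

/-- If `A * P = P * C` and `P` has a left inverse, then `det C` divides `det A`. -/
theorem det_dvd_det_of_mul_eq_mul {A : Matrix V V R} {P : Matrix V m R} {L : Matrix m V R}
    {C : Matrix m m R} (hAP : A * P = P * C) (hLP : L * P = 1) : C.det ∣ A.det := by
  have hfactor : A = (A + P * (1 - C) * L) * (1 - P * ((1 - C) * L)) := by
    have h : (A + P * (1 - C) * L) * P = P := by
      rw [Matrix.add_mul, Matrix.mul_assoc _ L P, hLP, hAP, Matrix.mul_one, ← Matrix.mul_add,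
        add_sub_cancel, Matrix.mul_one]
    rw [Matrix.mul_sub, ← Matrix.mul_assoc _ P, h, Matrix.mul_one, Matrix.mul_assoc P,
      add_sub_cancel_right]
  have hdet : (1 - P * ((1 - C) * L)).det = C.det := by
    rw [Matrix.det_one_sub_mul_comm, Matrix.mul_assoc, hLP, Matrix.mul_one, sub_sub_cancel]
  rw [hfactor, det_mul, hdet]
  exact dvd_mul_left _ _

/-- The characteristic polynomial of the quotient matrix of an equitable partition divides
the characteristic polynomial of the matrix. -/
theorem charpoly_dvd_charpoly_of_equitable {M : Matrix V V R} {B : Matrix m m R} {c : V → m}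
    (hc : Function.Surjective c)
    (h : ∀ v j, ∑ w, (if c w = j then M v w else 0) = B (c v) j) :
    B.charpoly ∣ M.charpoly := by
  obtain ⟨s, hs⟩ := hc.hasRightInverse
  let P : Matrix V m R := Matrix.of fun v j => if c v = j then 1 else 0
  let L : Matrix m V R := Matrix.of fun i v => if v = s i then 1 else 0
  have hMP : M * P = P * B := by
    ext v j
    simp [Matrix.mul_apply, P, h]
  have hLP : L * P = 1 := by
    ext i j
    simp only [Matrix.mul_apply, P, L, Matrix.of_apply, Matrix.one_apply, ite_mul, one_mul,
      zero_mul, Finset.sum_ite_eq', Finset.mem_univ, if_true, hs i]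
  refine det_dvd_det_of_mul_eq_mul (P := P.map Polynomial.C) (L := L.map Polynomial.C) ?_ ?_
  · have hMP' := congrArg (Matrix.map · Polynomial.C) hMP
    simp only [Matrix.map_mul] at hMP'
    have hX : (scalar V X : Matrix V V R[X]) * P.map Polynomial.C =
        P.map Polynomial.C * (scalar m X : Matrix m m R[X]) := by
      ext v j : 1
      rw [scalar_apply, scalar_apply, diagonal_mul, mul_diagonal, mul_comm]
    simp only [charmatrix, RingHom.mapMatrix_apply, Matrix.sub_mul, Matrix.mul_sub, hX, hMP']
  · rw [← Matrix.map_mul, hLP, Matrix.map_one _ (map_zero _) (map_one _)]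

end Matrix

/-- In a graph with a universal vertex, distinct non-adjacent vertices are at distance 2. -/
theorem SimpleGraph.dist_eq_ite_of_universal {V : Type*} [DecidableEq V] (G : SimpleGraph V)
    [DecidableRel G.Adj] {z : V} (hz : ∀ v, v ≠ z → G.Adj z v) (u v : V) :
    G.dist u v = if u = v then 0 else if G.Adj u v then 1 else 2 := by
  split_ifs with huv hadj
  · rw [huv, SimpleGraph.dist_self]
  · exact SimpleGraph.dist_eq_one_iff_adj.2 hadj
  · have hu : u ≠ z := by rintro rfl; exact hadj (hz v (Ne.symm huv))
    have hv : v ≠ z := by rintro rfl; exact hadj (hz u huv).symm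
    let w : G.Walk u v := .cons (hz u hu).symm (.cons (hz v hv) .nil)
    have h2 : G.dist u v ≤ 2 := G.dist_le w
    have h0 : 0 < G.dist u v := w.reachable.pos_dist_of_ne huv
    have h1 : G.dist u v ≠ 1 := fun h => hadj (SimpleGraph.dist_eq_one_iff_adj.1 h)
    omega

/-- The distance matrix of the cone over the paw graph, restricted to the paw. -/
def pawDist : Matrix (Fin 4) (Fin 4) ℝ :=
  !![0, 1, 1, 1; 1, 0, 2, 2; 1, 2, 0, 1; 1, 2, 1, 0]

theorem graphJoin_adj_inr_inr {α β : Type*} {G : SimpleGraph α} {H : SimpleGraph β} {a b : β} :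
    (graphJoin G H).Adj (inr a) (inr b) ↔ H.Adj a b := by
  simpa [graphJoin, H.adj_comm b a] using H.ne_of_adj

theorem graphSum_adj_inl_inl {α β : Type*} {G : SimpleGraph α} {H : SimpleGraph β} {a b : α} :
    (graphSum G H).Adj (inl a) (inl b) ↔ G.Adj a b := by
  simpa [graphSum, G.adj_comm b a] using G.ne_of_adj

theorem graphSum_adj_inr_inr {α β : Type*} {G : SimpleGraph α} {H : SimpleGraph β} {a b : β} :
    (graphSum G H).Adj (inr a) (inr b) ↔ H.Adj a b := by
  simpa [graphSum, H.adj_comm b a] using H.ne_of_adj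

section Grpq

variable {r p q : ℕ}

theorem Grpq_adj_center_inr (v : (Fin p × Fin r) ⊕ (Fin q × Fin 4)) :
    (Grpq r p q).Adj (inl ()) (inr v) := by
  simp [Grpq, graphJoin]

theorem Grpq_adj_clique_clique (a b : Fin p × Fin r) :
    (Grpq r p q).Adj (inr (inl a)) (inr (inl b)) ↔ a ≠ b ∧ a.1 = b.1 := by
  simp only [Grpq, graphJoin_adj_inr_inr, graphSum_adj_inl_inl, cliqueCopies,
    SimpleGraph.fromRel_adj, eq_comm (a := b.1), or_self]

theorem Grpq_adj_paw_paw (a b : Fin q × Fin 4) :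
    (Grpq r p q).Adj (inr (inr a)) (inr (inr b)) ↔ a.1 = b.1 ∧ a.2 ≠ b.2 ∧
      (a.2 = 0 ∨ b.2 = 0 ∨ a.2 = 2 ∧ b.2 = 3 ∨ b.2 = 2 ∧ a.2 = 3) := by
  obtain ⟨i, j⟩ := a
  obtain ⟨k, l⟩ := b
  simp only [Grpq, graphJoin_adj_inr_inr, graphSum_adj_inr_inr, pawCopies,
    SimpleGraph.fromRel_adj, eq_comm (a := k), ne_eq, Prod.mk.injEq]
  tauto

theorem Grpq_not_adj_clique_paw (a : Fin p × Fin r) (b : Fin q × Fin 4) :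
    ¬ (Grpq r p q).Adj (inr (inl a)) (inr (inr b)) := by
  simp [Grpq, graphJoin_adj_inr_inr, graphSum]

open Classical in
theorem dist_Grpq (u v : Unit ⊕ ((Fin p × Fin r) ⊕ (Fin q × Fin 4))) :
    (Grpq r p q).dist u v = if u = v then 0 else if (Grpq r p q).Adj u v then 1 else 2 := by
  refine (Grpq r p q).dist_eq_ite_of_universal (z := inl ()) ?_ u v
  rintro (_ | v) hv
  · exact absurd rfl hv
  · exact Grpq_adj_center_inr v

theorem dist_Grpq_center_inr (v : (Fin p × Fin r) ⊕ (Fin q × Fin 4)) :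
    (Grpq r p q).dist (inl ()) (inr v) = 1 :=
  SimpleGraph.dist_eq_one_iff_adj.2 (Grpq_adj_center_inr v)

theorem dist_Grpq_inr_center (v : (Fin p × Fin r) ⊕ (Fin q × Fin 4)) :
    (Grpq r p q).dist (inr v) (inl ()) = 1 := by
  rw [SimpleGraph.dist_comm, dist_Grpq_center_inr]

theorem dist_Grpq_clique_paw (a : Fin p × Fin r) (b : Fin q × Fin 4) :
    (Grpq r p q).dist (inr (inl a)) (inr (inr b)) = 2 := by
  rw [dist_Grpq, if_neg (by simp), if_neg (Grpq_not_adj_clique_paw a b)]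

theorem dist_Grpq_paw_clique (a : Fin p × Fin r) (b : Fin q × Fin 4) :
    (Grpq r p q).dist (inr (inr b)) (inr (inl a)) = 2 := by
  rw [SimpleGraph.dist_comm, dist_Grpq_clique_paw]

theorem dist_Grpq_clique_clique (i k : Fin p) (j l : Fin r) :
    ((Grpq r p q).dist (inr (inl (i, j))) (inr (inl (k, l))) : ℝ) =
      2 - (if i = k then 1 else 0) - (if i = k then if j = l then 1 else 0 else 0) := by
  simp only [dist_Grpq, Grpq_adj_clique_clique, inr.injEq, inl.injEq, Prod.mk.injEq, ne_eq]
  by_cases hik : i = k <;> by_cases hjl : j = l <;> simp [hik, hjl] <;> norm_num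

theorem dist_Grpq_paw_paw (i k : Fin q) (j l : Fin 4) :
    ((Grpq r p q).dist (inr (inr (i, j))) (inr (inr (k, l))) : ℝ) =
      2 + (if i = k then pawDist j l - 2 else 0) := by
  simp only [dist_Grpq, Grpq_adj_paw_paw, inr.injEq, Prod.mk.injEq, ne_eq]
  by_cases hik : i = k
  · fin_cases j <;> fin_cases l <;> simp [hik, pawDist]
  · simp [hik]

variable (r p q) in
/-- The quotient of the distance matrix of `G(r,p,q)` by the partition into the center, the
cliques, and the three vertex orbits of the paws. -/
def quotientGrpq : Matrix (Fin 5) (Fin 5) ℝ :=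
  !![0, p * r, q, q, 2 * q;
     1, 2 * p * r - r - 1, 2 * q, 2 * q, 4 * q;
     1, 2 * p * r, 2 * q - 2, 2 * q - 1, 4 * q - 2;
     1, 2 * p * r, 2 * q - 1, 2 * q - 2, 4 * q;
     1, 2 * p * r, 2 * q - 1, 2 * q, 4 * q - 3]

/-- The part of the partition underlying `quotientGrpq` that contains a given vertex. -/
def partGrpq : Unit ⊕ ((Fin p × Fin r) ⊕ (Fin q × Fin 4)) → Fin 5
  | inl _ => 0
  | inr (inl _) => 1
  | inr (inr (_, j)) => ![2, 3, 4, 4] j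

theorem partGrpq_surjective (hr : 0 < r) (hp : 0 < p) (hq : 0 < q) :
    Function.Surjective (partGrpq (r := r) (p := p) (q := q)) := by
  intro j
  fin_cases j
  · exact ⟨inl (), rfl⟩
  · exact ⟨inr (inl (⟨0, hp⟩, ⟨0, hr⟩)), rfl⟩
  · exact ⟨inr (inr (⟨0, hq⟩, 0)), rfl⟩
  · exact ⟨inr (inr (⟨0, hq⟩, 1)), rfl⟩
  · exact ⟨inr (inr (⟨0, hq⟩, 2)), rfl⟩

theorem sum_distMatrix_Grpq (v : Unit ⊕ ((Fin p × Fin r) ⊕ (Fin q × Fin 4))) (j : Fin 5) :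
    ∑ w, (if partGrpq w = j then distMatrix (Grpq r p q) v w else 0) =
      quotientGrpq r p q (partGrpq v) j := by
  rcases v with ⟨⟨⟩⟩ | ⟨i, k⟩ | ⟨i, k⟩
  · fin_cases j <;>
      simp [Fintype.sum_sum_type, Fintype.sum_prod_type, Fin.sum_univ_four, partGrpq, distMatrix,
        quotientGrpq, dist_Grpq_center_inr, -Finset.sum_boole]
    ring
  · fin_cases j <;>
      simp [Fintype.sum_sum_type, Fintype.sum_prod_type, Fin.sum_univ_four, partGrpq, distMatrix,
        quotientGrpq, dist_Grpq_inr_center, dist_Grpq_clique_paw, dist_Grpq_clique_clique,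
        Finset.sum_sub_distrib] <;> ring
  · fin_cases k <;> fin_cases j <;>
      simp [Fintype.sum_sum_type, Fintype.sum_prod_type, Fin.sum_univ_four, partGrpq, distMatrix,
        quotientGrpq, dist_Grpq_inr_center, dist_Grpq_paw_clique, dist_Grpq_paw_paw, pawDist,
        Finset.sum_add_distrib] <;> ring

theorem charpoly_quotientGrpq : (quotientGrpq r p q).charpoly = fpoly r p q := by
  rw [Matrix.charpoly, Matrix.charmatrix, quotientGrpq, fpoly]
  simp [Matrix.det_succ_row_zero, Fin.sum_univ_succ, Fin.succAbove]
  simp only [map_ofNat]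
  ring

end Grpq

/-- For `r, p, q ≥ 1`, the quintic `f(r,p,q,x)` divides the characteristic
polynomial of the distance matrix of `G(r,p,q)`. -/
theorem stmt_12 (r p q : ℕ) (hr : 0 < r) (hp : 0 < p) (hq : 0 < q) :
    fpoly r p q ∣ (distMatrix (Grpq r p q)).charpoly := by
  rw [← charpoly_quotientGrpq]
  exact Matrix.charpoly_dvd_charpoly_of_equitable (partGrpq_surjective hr hp hq)
    sum_distMatrix_Grpq
end

section
/- For all integers r, p, q ≥ 1, the characteristic polynomial of the distance matrix of G(r,p,q) = K_1 ⊕ (p K_r ∪ q(K_1 ⊕ (K_1 ∪ K_2))) factors in ℝ[x] as (x+1)^{p(r−1)+q} · (x + (r+1))^{p−1} · (x^3 + 7x^2 + 13x + 5)^{q−1} · f(r,p,q,x), where f(r,p,q,x) = x^5 − A x^4 − B x^3 − C x^2 − D x − E with A = 8q + 2rp − r − 8, B = (8r+36)q + 15rp − 7r − 20, C = (28r+52)q + 33rp − 13r − 18, D = (24r+30)q + 23rp − 5r − 5, E = (6r+6)q + 5rp. Moreover, every real root of (x+1), of (x + (r+1)) and of x^3 + 7x^2 + 13x + 5 is less than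 −1/2. -/
open Polynomial SimpleGraph Sum

/-- Distances between the non-apex vertices of a cone. -/
theorem dist_cone_inr {β : Type*} [DecidableEq β] (H : SimpleGraph β) [DecidableRel H.Adj]
    (a b : β) :
    (graphJoin (⊤ : SimpleGraph Unit) H).dist (inr a) (inr b) =
      if a = b then 0 else if H.Adj a b then 1 else 2 := by
  have h_adj : (graphJoin (⊤ : SimpleGraph Unit) H).Adj (inr a) (inr b) ↔ H.Adj a b := by
    simp only [graphJoin, SimpleGraph.fromRel_adj]
    constructor
    · rintro ⟨-, h⟩
      simpa [H.adj_comm b a] using h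
    · intro h
      exact ⟨fun e => h.ne (inr_injective e), by simp [h]⟩
  have h_left : (graphJoin (⊤ : SimpleGraph Unit) H).Adj (inr a) (inl ()) := by
    simp [graphJoin]
  have h_right : (graphJoin (⊤ : SimpleGraph Unit) H).Adj (inl ()) (inr b) := by
    simp [graphJoin]
  split_ifs with hab h
  · simp [hab]
  · exact SimpleGraph.dist_eq_one_iff_adj.2 (h_adj.2 h)
  · have h_le := SimpleGraph.dist_le (h_left.toWalk.append h_right.toWalk)
    have h_ne_one := mt SimpleGraph.dist_eq_one_iff_adj.1 (mt h_adj.1 h)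
    have h_pos := (h_left.reachable.trans h_right.reachable).pos_dist_of_ne
      (fun e => hab (inr_injective e))
    simp at h_le
    omega

theorem dist_cone_inl_inr {β : Type*} (H : SimpleGraph β) (u : Unit) (b : β) :
    (graphJoin (⊤ : SimpleGraph Unit) H).dist (inl u) (inr b) = 1 :=
  SimpleGraph.dist_eq_one_iff_adj.2 (by simp [graphJoin])

/-- The characteristic matrix of a cone whose base has characteristic distance matrix
`N - 2J` has determinant `det N * (x - (1 + 2x) * ∑ w)` whenever `N w` is the all-ones vector. -/
theorem det_cone {m : Type*} [Fintype m] [DecidableEq m] (x : ℝ) (N : Matrix m m ℝ) (w : m → ℝ)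
    (hw : N.mulVec w = 1) :
    (Matrix.fromBlocks (Matrix.of fun _ _ : Unit => x) (Matrix.of fun _ _ => -1)
      (Matrix.of fun _ _ => -1) (N - Matrix.of fun _ _ => 2)).det =
      N.det * (x - (1 + 2 * x) * ∑ i, w i) := by
  have h_mul : Matrix.fromBlocks (1 : Matrix Unit Unit ℝ) 0 (Matrix.of fun _ _ => -2) 1 *
      Matrix.fromBlocks (Matrix.of fun _ _ : Unit => x) (Matrix.of fun _ _ => -1)
        (Matrix.of fun _ _ => -1) (N - Matrix.of fun _ _ => 2) *
      Matrix.fromBlocks (1 : Matrix Unit Unit ℝ) 0 (Matrix.of fun i _ => (1 + 2 * x) * w i) 1 =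
      Matrix.fromBlocks (Matrix.of fun _ _ : Unit => x - (1 + 2 * x) * ∑ i, w i)
        (Matrix.of fun _ _ => -1) 0 N := by
    simp only [Matrix.fromBlocks_multiply, Matrix.one_mul, Matrix.zero_mul, Matrix.mul_one,
      Matrix.mul_zero, zero_add, add_zero]
    congr 1
    · ext i j
      simp [Matrix.mul_apply, Finset.mul_sum, sub_eq_add_neg]
    · ext i j
      have h := congrFun hw i
      simp only [Matrix.mulVec, dotProduct, Pi.one_apply] at h
      have h' : ∑ k, N i k * ((1 + 2 * x) * w k) = 1 + 2 * x := by
        simp_rw [mul_left_comm _ (1 + 2 * x), ← Finset.mul_sum, h, mul_one]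
      simp only [Matrix.add_apply, Matrix.mul_apply, Matrix.of_apply, Matrix.zero_apply,
        Matrix.sub_apply, Finset.univ_unique, Finset.sum_singleton]
      have h_entry (k : m) : -2 * -1 + (N i k - 2) = N i k := by ring
      simp only [h_entry, h']
      ring
    · ext i j
      simp [Matrix.mul_apply]
  have h_det := congrArg Matrix.det h_mul
  simpa [Matrix.det_fromBlocks_zero₁₂, Matrix.det_fromBlocks_zero₂₁, mul_comm] using h_det

theorem det_smul_one_add_ones (r : ℕ) (hr : 0 < r) (y : ℝ) (hy : y ≠ 0) :
    (y • (1 : Matrix (Fin r) (Fin r) ℝ) + Matrix.of fun _ _ => 1).det = y ^ (r - 1) * (y + r) := by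
  have h : y • (1 : Matrix (Fin r) (Fin r) ℝ) + Matrix.of (fun _ _ => 1) =
      y • ((1 : Matrix (Fin r) (Fin r) ℝ) +
        (Matrix.replicateCol Unit (fun _ => y⁻¹) : Matrix (Fin r) Unit ℝ) *
          (Matrix.replicateRow Unit (fun _ => 1) : Matrix Unit (Fin r) ℝ)) := by
    ext i j
    simp [Matrix.mul_apply, mul_add, hy]
  rw [h, Matrix.det_smul, Matrix.det_one_add_replicateCol_mul_replicateRow]
  obtain ⟨s, rfl⟩ : ∃ s, r = s + 1 := ⟨r - 1, by omega⟩
  simp [dotProduct, pow_succ]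
  field_simp

/-- For the paw graph, `x • 1 + 2J` minus the distance matrix. -/
noncomputable def pawBlock (x : ℝ) : Matrix (Fin 4) (Fin 4) ℝ :=
  !![x + 2, 1, 1, 1; 1, x + 2, 0, 0; 1, 0, x + 2, 1; 1, 0, 1, x + 2]

theorem det_pawBlock (x : ℝ) :
    (pawBlock x).det = (x + 1) * (x ^ 3 + 7 * x ^ 2 + 13 * x + 5) := by
  simp [pawBlock, Matrix.det_succ_row_zero, Fin.sum_univ_succ, Fin.succAbove]
  ring

/-- The solution of `pawBlock x *ᵥ w = 1`. -/
noncomputable def pawSolution (x : ℝ) : Fin 4 → ℝ :=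
  (x ^ 3 + 7 * x ^ 2 + 13 * x + 5)⁻¹ •
    ![x ^ 2 + 2 * x - 1, (x + 1) * (x + 3), (x + 1) * (x + 2), (x + 1) * (x + 2)]

theorem pawBlock_mulVec (x : ℝ) (hx : x ^ 3 + 7 * x ^ 2 + 13 * x + 5 ≠ 0) :
    (pawBlock x).mulVec (pawSolution x) = 1 := by
  rw [pawSolution, Matrix.mulVec_smul]
  ext i
  rw [Pi.smul_apply, smul_eq_mul, inv_mul_eq_iff_eq_mul₀ hx]
  fin_cases i <;> simp [pawBlock, Matrix.mulVec, dotProduct, Fin.sum_univ_succ] <;> ring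

theorem kronecker_one_mulVec {m n : Type*} [Fintype m] [Fintype n] [DecidableEq m]
    (A : Matrix n n ℝ) (w : n → ℝ) (hw : A.mulVec w = 1) :
    (Matrix.kronecker (1 : Matrix m m ℝ) A).mulVec (fun i => w i.2) = 1 := by
  ext ⟨i, k⟩
  have h := congrFun hw k
  simp only [Matrix.mulVec, dotProduct, Pi.one_apply] at h ⊢
  simp [Fintype.sum_prod_type, Matrix.kronecker, Matrix.one_apply, h]

/-- The base block of the characteristic matrix of `D(G(r,p,q))`, shifted by `2J`. -/
noncomputable def baseBlock (r p q : ℕ) (x : ℝ) :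
    Matrix ((Fin p × Fin r) ⊕ (Fin q × Fin 4)) ((Fin p × Fin r) ⊕ (Fin q × Fin 4)) ℝ :=
  Matrix.fromBlocks
    (Matrix.kronecker 1 ((x + 1) • (1 : Matrix (Fin r) (Fin r) ℝ) + Matrix.of fun _ _ => 1)) 0 0
    (Matrix.kronecker 1 (pawBlock x))

theorem det_baseBlock (r p q : ℕ) (hr : 0 < r) (x : ℝ) (hx : x + 1 ≠ 0) :
    (baseBlock r p q x).det = ((x + 1) ^ (r - 1) * (x + 1 + r)) ^ p *
      ((x + 1) * (x ^ 3 + 7 * x ^ 2 + 13 * x + 5)) ^ q := by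
  rw [baseBlock, Matrix.det_fromBlocks_zero₂₁]
  simp only [Matrix.kronecker, Matrix.det_kronecker, det_smul_one_add_ones r hr _ hx,
    det_pawBlock]
  simp

theorem baseBlock_mulVec (r p q : ℕ) (x : ℝ) (hx : x + 1 + r ≠ 0)
    (hx' : x ^ 3 + 7 * x ^ 2 + 13 * x + 5 ≠ 0) :
    (baseBlock r p q x).mulVec
      (Sum.elim (fun _ => (x + 1 + r)⁻¹) fun i => pawSolution x i.2) = 1 := by
  have h_clique : ((x + 1) • (1 : Matrix (Fin r) (Fin r) ℝ) + Matrix.of fun _ _ => 1).mulVec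
      (fun _ => (x + 1 + r)⁻¹) = 1 := by
    ext i
    simp [Matrix.mulVec, dotProduct, add_mul, Finset.sum_add_distrib, Matrix.one_apply]
    field_simp
  rw [baseBlock, Matrix.fromBlocks_mulVec]
  have h₁ := kronecker_one_mulVec (m := Fin p) _ _ h_clique
  have h₂ := kronecker_one_mulVec (m := Fin q) _ _ (pawBlock_mulVec x hx')
  ext (i | i)
  · simpa [Function.comp_def] using congrFun h₁ i
  · simpa [Function.comp_def] using congrFun h₂ i

theorem scalar_sub_distMatrix_Grpq (r p q : ℕ) (x : ℝ) :
    Matrix.scalar _ x - distMatrix (Grpq r p q) =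
      Matrix.fromBlocks (Matrix.of fun _ _ : Unit => x) (Matrix.of fun _ _ => -1)
        (Matrix.of fun _ _ => -1) (baseBlock r p q x - Matrix.of fun _ _ => 2) := by
  classical
  ext (u | a) (v | b)
  · simp [distMatrix]
  · simp [distMatrix, Grpq, dist_cone_inl_inr]
  · simp [distMatrix, Grpq, dist_cone_inl_inr, SimpleGraph.dist_comm (u := inr a)]
  · simp only [distMatrix, Grpq, Matrix.sub_apply, Matrix.of_apply, dist_cone_inr,
      Matrix.fromBlocks_apply₂₂, baseBlock, Matrix.scalar_apply, Matrix.diagonal_apply,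
      inr.injEq]
    rcases a with ⟨i, k⟩ | ⟨i, k⟩ <;> rcases b with ⟨j, l⟩ | ⟨j, l⟩
    · by_cases hij : i = j
      · by_cases hkl : k = l <;>
          simp [hij, hkl, graphSum, cliqueCopies, Matrix.kronecker] <;> ring
      · simp [hij, Ne.symm hij, graphSum, cliqueCopies, Matrix.kronecker]
    · simp [graphSum]
    · simp [graphSum]
    · by_cases hij : i = j
      · subst hij
        fin_cases k <;> fin_cases l <;>
          simp [graphSum, pawCopies, Matrix.kronecker, pawBlock] <;> ring
      · simp [hij, Ne.symm hij, graphSum, pawCopies, Matrix.kronecker]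

/-- For `r, p, q ≥ 1`, the characteristic polynomial of the distance matrix of
`G(r,p,q)` factors as stated, and all the real roots of the first three factors
are less than `-1/2`. -/
theorem stmt_13 (r p q : ℕ) (hr : 0 < r) (hp : 0 < p) (hq : 0 < q) :
    ((distMatrix (Grpq r p q)).charpoly =
      (X + 1) ^ (p * (r - 1) + q) * (X + C ((r : ℝ) + 1)) ^ (p - 1) *
        (X ^ 3 + 7 * X ^ 2 + 13 * X + 5) ^ (q - 1) * fpoly r p q) ∧
    (∀ x : ℝ,
      (x + 1 = 0 ∨ x + ((r : ℝ) + 1) = 0 ∨ x ^ 3 + 7 * x ^ 2 + 13 * x + 5 = 0) →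
        x < -1/2) := by
  constructor
  · refine Polynomial.eq_of_infinite_eval_eq _ _ ((Set.Ioi_infinite (0 : ℝ)).mono fun x hx => ?_)
    have hx : 0 < x := hx
    have h_clique : x + 1 + (r : ℝ) ≠ 0 := by positivity
    have h_cubic : x ^ 3 + 7 * x ^ 2 + 13 * x + 5 ≠ 0 := by positivity
    rw [Set.mem_ofPred_eq, Matrix.eval_charpoly, scalar_sub_distMatrix_Grpq,
      det_cone x _ _ (baseBlock_mulVec r p q x h_clique h_cubic),
      det_baseBlock r p q hr x (by positivity)]
    have h_sum : ∑ i, pawSolution x i =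
        (4 * x ^ 2 + 12 * x + 6) / (x ^ 3 + 7 * x ^ 2 + 13 * x + 5) := by
      simp [pawSolution, Fin.sum_univ_succ]
      ring
    obtain ⟨p, rfl⟩ : ∃ n, p = n + 1 := ⟨p - 1, by omega⟩
    obtain ⟨q, rfl⟩ : ∃ n, q = n + 1 := ⟨q - 1, by omega⟩
    have h_clique_eval : x + ((r : ℝ) + 1) = x + 1 + r := by ring
    simp [Fintype.sum_sum_type, Fintype.sum_prod_type, h_sum, fpoly, h_clique_eval]
    rw [mul_pow, mul_pow, ← pow_mul, mul_comm (r - 1)]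
    simp only [pow_add, pow_one]
    field_simp
    ring
  · rintro x (hx | hx | hx)
    · linarith
    · have : (0 : ℝ) < r := by exact_mod_cast hr
      linarith
    · by_contra! h
      nlinarith [pow_nonneg (sub_nonneg.2 h) 3, pow_nonneg (sub_nonneg.2 h) 2]
end
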